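/- Let q be a prime power, and n, m, t, ℓ positive integers with m ≤ t, m < q. If e * [C(ℓ,t) - C(ℓ-t,t)] * (m/q)^n ≤ 1 (where C(ℓ-t,t) is taken as 0 if ℓ < 2t), then there exists a sequence S of length ℓ over F_q^n such that every subsequence S' of S of length t satisfies e_m(S') ≠ 0. -/

import Mathlib

open Finset

/-- The symmetric **Lovász Local Lemma** on a finite sample space with uniform distribution, where
independence is weakened to an upper bound on conditional probabilities. -/
theorem lovasz_local_lemma {Ω ι : Type*} [Fintype Ω] [DecidableEq ι] (E : ι → Ω → Prop)
    (V : Finset ι) (Γ : ι → Finset ι) (d : ℕ) (p x : ℝ) (hx0 : 0 ≤ x) (hx1 : x < 1)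
    (hp : p ≤ x * (1 - x) ^ d)
    (hself : ∀ a ∈ V, a ∈ Γ a) (hcard : ∀ a ∈ V, #(Γ a) ≤ d + 1)
    (hE : ∀ a ∈ V, ∀ T ⊆ V, Disjoint T (Γ a) →
      (Nat.card {ω // E a ω ∧ ∀ b ∈ T, ¬ E b ω} : ℝ) ≤ p * Nat.card {ω // ∀ b ∈ T, ¬ E b ω}) :
    (1 - x) ^ #V * Nat.card Ω ≤ Nat.card {ω // ∀ b ∈ V, ¬ E b ω} := by
  classical
  have hx : 0 ≤ 1 - x := by linarith
  have hinsert (b : ι) (T : Finset ι) : (Nat.card {ω // ∀ c ∈ T, ¬ E c ω} : ℝ) =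
      Nat.card {ω // E b ω ∧ ∀ c ∈ T, ¬ E c ω} + Nat.card {ω // ∀ c ∈ insert b T, ¬ E c ω} := by
    simp only [Nat.card_eq_fintype_card, Fintype.card_subtype]
    rw [← card_filter_add_card_filter_not (s := {ω | ∀ c ∈ T, ¬ E c ω}) (E b)]
    simp only [filter_filter, forall_mem_insert, and_comm, Nat.cast_add]
  have peel (T₀ : Finset ι) (U : Finset ι)
      (hU : ∀ b ∈ U, ∀ T ⊆ U, b ∉ T → (Nat.card {ω // E b ω ∧ ∀ c ∈ T ∪ T₀, ¬ E c ω} : ℝ)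
        ≤ x * Nat.card {ω // ∀ c ∈ T ∪ T₀, ¬ E c ω}) :
      (1 - x) ^ #U * Nat.card {ω // ∀ c ∈ T₀, ¬ E c ω} ≤
        (Nat.card {ω // ∀ c ∈ U ∪ T₀, ¬ E c ω} : ℝ) := by
    induction U using Finset.induction_on with
    | empty => simp
    | insert b U hb ih =>
      have h₁ := ih fun c hc T hT => hU c (mem_insert_of_mem hc) T (hT.trans (subset_insert _ _))
      have h₂ := hU b (mem_insert_self _ _) U (subset_insert _ _) hb
      have h₃ := hinsert b (U ∪ T₀)
      rw [insert_union, card_insert_of_notMem hb, pow_succ]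
      nlinarith [mul_le_mul_of_nonneg_left h₁ hx]
  have key (k : ℕ) : ∀ T ⊆ V, #T = k → ∀ a ∈ V, a ∉ T →
      (Nat.card {ω // E a ω ∧ ∀ c ∈ T, ¬ E c ω} : ℝ) ≤
        x * Nat.card {ω // ∀ c ∈ T, ¬ E c ω} := by
    induction k using Nat.strong_induction_on with
    | _ k ih =>
      intro T hT hk a ha haT
      have hsplit : T ∩ Γ a ∪ T \ Γ a = T := by
        rw [union_comm]; exact sdiff_union_inter T (Γ a)
      have h₁ := peel (T \ Γ a) (T ∩ Γ a) fun b hb U hU hbU => by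
        have hbT : b ∉ U ∪ T \ Γ a := by
          simp only [mem_union, mem_sdiff, not_or]
          exact ⟨hbU, fun h => h.2 (mem_inter.1 hb).2⟩
        have hsub : U ∪ T \ Γ a ⊆ T := by
          conv_rhs => rw [← hsplit]
          exact union_subset_union_left hU
        refine ih _ ?_ _ (hsub.trans hT) rfl b (hT (mem_inter.1 hb).1) hbT
        rw [← hk]
        exact card_lt_card ⟨hsub, fun h => hbT (h (mem_inter.1 hb).1)⟩
      rw [hsplit] at h₁
      have h₂ := hE a ha (T \ Γ a) (sdiff_subset.trans hT) sdiff_disjoint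
      have h₃ : (Nat.card {ω // E a ω ∧ ∀ c ∈ T, ¬ E c ω} : ℝ) ≤
          Nat.card {ω // E a ω ∧ ∀ c ∈ T \ Γ a, ¬ E c ω} := by
        have hsub (ω : Ω) (h : E a ω ∧ ∀ c ∈ T, ¬ E c ω) : E a ω ∧ ∀ c ∈ T \ Γ a, ¬ E c ω :=
          ⟨h.1, fun c hc => h.2 c (mem_sdiff.1 hc).1⟩
        exact_mod_cast Nat.card_le_card_of_injective (Subtype.map id hsub)
          (Subtype.map_injective hsub Function.injective_id)
      have h₄ : #(T ∩ Γ a) ≤ d := by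
        have : #(T ∩ Γ a) ≤ #((Γ a).erase a) := card_le_card fun b hb => by
          rw [mem_inter] at hb
          exact mem_erase.2 ⟨fun h => haT (h ▸ hb.1), hb.2⟩
        rw [card_erase_of_mem (hself a ha)] at this
        have := hcard a ha
        omega
      calc _ ≤ _ := h₃
        _ ≤ _ := h₂
        _ ≤ x * (1 - x) ^ d * Nat.card {ω // ∀ c ∈ T \ Γ a, ¬ E c ω} := by gcongr
        _ ≤ x * (1 - x) ^ #(T ∩ Γ a) * Nat.card {ω // ∀ c ∈ T \ Γ a, ¬ E c ω} := by
          gcongr ?_ * ?_ * _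
          exact pow_le_pow_of_le_one hx (by linarith) h₄
        _ ≤ _ := by rw [mul_assoc]; gcongr
  have := peel ∅ V fun b hb T hT hbT => by
    simpa using key _ T hT rfl b hb hbT
  simpa using this

theorem exists_le_mul_one_sub_pow (d : ℕ) (p : ℝ) (h : Real.exp 1 * (d + 1) * p ≤ 1) :
    ∃ x : ℝ, 0 ≤ x ∧ x < 1 ∧ p ≤ x * (1 - x) ^ d := by
  have he := Real.exp_pos 1
  rcases Nat.eq_zero_or_pos d with rfl | hd
  · refine ⟨(Real.exp 1)⁻¹, by positivity, inv_lt_one_of_one_lt₀ (by simp), ?_⟩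
    rw [pow_zero, mul_one, ← one_div, le_div_iff₀ he]
    rw [Nat.cast_zero, zero_add, mul_one] at h
    linarith
  · have hd' : (0 : ℝ) < d := by exact_mod_cast hd
    refine ⟨1 / (d + 1), by positivity, by rw [div_lt_one (by positivity)]; linarith, ?_⟩
    have h₁ : (1 + 1 / (d : ℝ)) ^ d ≤ Real.exp 1 := by
      calc _ ≤ (Real.exp (1 / d)) ^ d := by
            gcongr
            linarith [Real.add_one_le_exp (1 / (d : ℝ))]
        _ = _ := by rw [← Real.exp_nat_mul]; congr 1; field_simp
    have h₂ : (1 - 1 / ((d : ℝ) + 1)) = (1 + 1 / (d : ℝ))⁻¹ := by field_simp; ring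
    rw [h₂, inv_pow]
    calc p ≤ 1 / (d + 1) * (Real.exp 1)⁻¹ := by field_simp; linarith
      _ ≤ _ := by gcongr

theorem card_subtype_restrict_and {ι α : Type*} [Fintype ι] [Fintype α] [DecidableEq ι]
    (A : Finset ι) (P : ({i // i ∈ A} → α) → Prop) (Q : ({i // i ∉ A} → α) → Prop) :
    Nat.card {S : ι → α // P (fun i => S i) ∧ Q (fun i => S i)} =
      Nat.card {y // P y} * Nat.card {z // Q z} := by
  rw [← Nat.card_prod, ← Nat.card_congr (Equiv.subtypeProdEquivProd (p := P) (q := Q))]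
  exact Nat.card_congr ((Equiv.piEquivPiSubtypeProd (· ∈ A) fun _ => α).subtypeEquiv
    fun _ => Iff.rfl)

/-- An elementary symmetric function of degree `m` vanishes on at most an `m / q` proportion of the
points with coordinates in a field with `q` elements. -/
theorem card_esymm_eq_zero_le {σ F : Type*} [Fintype σ] [Field F] [Fintype F] {m : ℕ}
    (hm : m ≤ Fintype.card σ) :
    (Nat.card {y : σ → F // ∑ c ∈ powersetCard m univ, ∏ i ∈ c, y i = 0} : ℝ) ≤
      m / Fintype.card F * Nat.card (σ → F) := by
  classical
  set k := Fintype.card σ with hk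
  have hp : (MvPolynomial.esymm (Fin k) F m).support =
      (powersetCard m univ).image fun t => ∑ i ∈ t, Finsupp.single i 1 :=
    MvPolynomial.support_esymm _ _ _
  have hp0 : MvPolynomial.esymm (Fin k) F m ≠ 0 := by
    rw [← MvPolynomial.support_nonempty, hp, image_nonempty, powersetCard_nonempty]
    simpa using hm
  have hdeg : (MvPolynomial.esymm (Fin k) F m).totalDegree ≤ m := by
    refine Finset.sup_le fun s hs => ?_
    rw [hp, mem_image] at hs
    obtain ⟨t, ht, rfl⟩ := hs
    rw [Finsupp.sum_of_support_subset (s := univ) _ (subset_univ _) _ (by simp)]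
    simp [Finsupp.finsetSum_apply, Finsupp.single_apply, (mem_powersetCard.1 ht).2]
  have hsz := MvPolynomial.schwartz_zippel_totalDegree hp0 (univ : Finset F)
  have hcard : Nat.card {y : σ → F // ∑ c ∈ powersetCard m univ, ∏ i ∈ c, y i = 0} =
      #{f ∈ Fintype.piFinset fun _ : Fin k => (univ : Finset F) |
        MvPolynomial.eval f (MvPolynomial.esymm (Fin k) F m) = 0} := by
    rw [Fintype.piFinset_univ, ← Fintype.card_subtype, ← Nat.card_eq_fintype_card]
    refine Nat.card_congr ((Equiv.arrowCongr (Fintype.equivFin σ) (Equiv.refl F)).subtypeEquiv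
      fun y => ?_)
    rw [← MvPolynomial.coe_aeval_eq_eval, RingHom.coe_coe,
      MvPolynomial.aeval_esymm_eq_multiset_esymm, ← esymm_map_val,
      ← Multiset.map_univ_val_equiv (Fintype.equivFin σ), Multiset.map_map]
    simp [Function.comp_def]
  have hF : (0 : ℝ) < Fintype.card F := by exact_mod_cast Fintype.card_pos
  have hsz' := (NNRat.cast_le (K := ℝ)).2 hsz
  push_cast [card_univ] at hsz'
  rw [hcard, ← div_le_iff₀ (by exact_mod_cast Nat.card_pos), Nat.card_fun,
    Nat.card_eq_fintype_card, Nat.card_eq_fintype_card, Nat.cast_pow]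
  refine hsz'.trans ?_
  gcongr

theorem card_vector_esymm_eq_zero_le {σ F : Type*} [Fintype σ] [Field F] [Fintype F] {m : ℕ}
    (n : ℕ) (hm : m ≤ Fintype.card σ) :
    (Nat.card {y : σ → Fin n → F // ∑ c ∈ powersetCard m univ, ∏ i ∈ c, y i = 0} : ℝ) ≤
      (m / Fintype.card F) ^ n * Nat.card (σ → Fin n → F) := by
  have h₁ : Nat.card {y : σ → Fin n → F // ∑ c ∈ powersetCard m univ, ∏ i ∈ c, y i = 0} =
      Nat.card {y : σ → F // ∑ c ∈ powersetCard m univ, ∏ i ∈ c, y i = 0} ^ n := by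
    rw [← Nat.card_fin n, ← Nat.card_fun, Nat.card_fin n]
    refine Nat.card_congr (((Equiv.piComm fun _ _ => F).subtypeEquiv fun y => ?_).trans
      (Equiv.subtypePiEquivPi
        (p := fun _ (y : σ → F) => ∑ c ∈ powersetCard m univ, ∏ i ∈ c, y i = 0)))
    simp [funext_iff, Finset.sum_apply, Finset.prod_apply]
  have h₂ : Nat.card (σ → Fin n → F) = Nat.card (σ → F) ^ n := by
    rw [Nat.card_fun, Nat.card_fun, Nat.card_fun, Nat.card_fin, ← pow_mul, ← pow_mul, mul_comm]
  rw [h₁, h₂, Nat.cast_pow, Nat.cast_pow, ← mul_pow]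
  gcongr
  exact card_esymm_eq_zero_le hm

theorem sum_powersetCard_prod_map {σ τ R : Type*} [CommSemiring R] (f : σ ↪ τ) (s : Finset σ)
    (m : ℕ) (S : τ → R) :
    ∑ c ∈ powersetCard m (s.map f), ∏ i ∈ c, S i =
      ∑ c ∈ powersetCard m s, ∏ i ∈ c, S (f i) := by
  rw [← esymm_map_val, ← esymm_map_val, map_val, Multiset.map_map]
  rfl

theorem card_filter_not_disjoint_powersetCard {ι : Type*} [Fintype ι] [DecidableEq ι] {t : ℕ}
    {A : Finset ι} (hA : #A = t) :
    (#{B ∈ powersetCard t univ | ¬ Disjoint A B} : ℝ) =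
      (Fintype.card ι).choose t - (Fintype.card ι - t).choose t := by
  have h₁ : {B ∈ powersetCard t (univ : Finset ι) | Disjoint A B} = powersetCard t Aᶜ := by
    ext B
    simp [mem_powersetCard, subset_compl_iff_disjoint_left, and_comm]
  have h₂ := card_filter_add_card_filter_not (s := powersetCard t (univ : Finset ι))
    (fun B => Disjoint A B)
  rw [h₁, card_powersetCard, card_powersetCard, card_compl, hA, card_univ] at h₂
  rw [← h₂]
  push_cast
  ring

theorem card_esymm_eq_zero_and_avoid_le {ι F : Type*} [Fintype ι] [DecidableEq ι] [Field F]
    [Fintype F] {m n : ℕ} {A : Finset ι} (hm : m ≤ #A) {T : Finset (Finset ι)}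
    (hT : ∀ B ∈ T, Disjoint A B) :
    (Nat.card {S : ι → Fin n → F // ∑ c ∈ powersetCard m A, ∏ i ∈ c, S i = 0 ∧
        ∀ B ∈ T, ¬ ∑ c ∈ powersetCard m B, ∏ i ∈ c, S i = 0} : ℝ) ≤
      (m / Fintype.card F) ^ n * Nat.card {S : ι → Fin n → F //
        ∀ B ∈ T, ¬ ∑ c ∈ powersetCard m B, ∏ i ∈ c, S i = 0} := by
  let P (y : {i // i ∈ A} → Fin n → F) : Prop := ∑ c ∈ powersetCard m univ, ∏ i ∈ c, y i = 0
  let Q (z : {i // i ∉ A} → Fin n → F) : Prop := ∀ B ∈ T,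
    ¬ ∑ c ∈ powersetCard m B, ∏ i ∈ c, (if h : i ∉ A then z ⟨i, h⟩ else 0) = 0
  have hP (S : ι → Fin n → F) :
      ∑ c ∈ powersetCard m A, ∏ i ∈ c, S i = 0 ↔ P fun i => S i := by
    have := sum_powersetCard_prod_map (Function.Embedding.subtype (· ∈ A)) univ m S
    rw [univ_eq_attach, attach_map_val] at this
    rw [this]
    rfl
  have hQ (S : ι → Fin n → F) :
      (∀ B ∈ T, ¬ ∑ c ∈ powersetCard m B, ∏ i ∈ c, S i = 0) ↔ Q fun i => S i := by
    refine forall₂_congr fun B hB => not_congr ?_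
    rw [sum_congr rfl fun c hc => prod_congr rfl fun i hi => ?_]
    rw [dif_pos (disjoint_right.1 (hT B hB) ((mem_powersetCard.1 hc).1 hi))]
  simp only [hP, hQ]
  have h₁ := card_subtype_restrict_and A (fun _ => True) Q
  simp only [true_and] at h₁
  rw [card_subtype_restrict_and A P Q, h₁, Nat.card_congr (Equiv.subtypeUnivEquiv fun _ => trivial)]
  push_cast
  rw [← mul_assoc]
  gcongr
  exact card_vector_esymm_eq_zero_le n (by simpa using hm)

/-- Lovász Local Lemma lower bound: if `e·(C(ℓ,t) - C(ℓ-t,t))·(m/q)^n ≤ 1`, then there is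
a sequence of length `ℓ` over `F_q^n` in which every subsequence of length `t` has
`e_m ≠ 0`. (Here `C(ℓ-t,t)` uses truncated subtraction, so it is `0` when `ℓ < 2t`.) -/
theorem lll_lower_bound (q n m t ℓ : ℕ) (hq : IsPrimePow q)
    (hn : 0 < n) (hm : 0 < m) (ht : 0 < t) (hℓ : 0 < ℓ) (hmt : m ≤ t) (hmq : m < q)
    (F : Type*) [Field F] [Fintype F] (hF : Fintype.card F = q)
    (h : Real.exp 1 * ((ℓ.choose t : ℝ) - ((ℓ - t).choose t : ℝ)) * ((m : ℝ) / q) ^ n ≤ 1) :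
    ∃ S : Fin ℓ → (Fin n → F), ∀ f : Fin t → Fin ℓ, StrictMono f →
      (∑ c ∈ Finset.powersetCard m (Finset.univ : Finset (Fin t)),
        ∏ i ∈ c, S (f i)) ≠ 0 := by
  classical
  rcases lt_or_ge ℓ t with hlt | hle
  · refine ⟨0, fun f hf => ?_⟩
    have := Fintype.card_le_of_injective f hf.injective
    simp only [Fintype.card_fin] at this
    omega
  subst hF
  let E (A : Finset (Fin ℓ)) (S : Fin ℓ → Fin n → F) : Prop :=
    ∑ c ∈ powersetCard m A, ∏ i ∈ c, S i = 0
  let Γ (A : Finset (Fin ℓ)) : Finset (Finset (Fin ℓ)) :=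
    {B ∈ powersetCard t univ | ¬ Disjoint A B}
  have hself : ∀ A ∈ powersetCard t univ, A ∈ Γ A := fun A hA => by
    refine mem_filter.2 ⟨hA, ?_⟩
    rw [disjoint_self_iff_empty, ← card_eq_zero, (mem_powersetCard.1 hA).2]
    exact ht.ne'
  have hΓ : ∀ A ∈ powersetCard t univ, (#(Γ A) : ℝ) = ℓ.choose t - (ℓ - t).choose t :=
    fun A hA => by
      simpa using card_filter_not_disjoint_powersetCard (mem_powersetCard.1 hA).2
  obtain ⟨A₀, hA₀⟩ : (powersetCard t (univ : Finset (Fin ℓ))).Nonempty := by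
    simpa [powersetCard_nonempty] using hle
  obtain ⟨d, hd⟩ := Nat.exists_eq_succ_of_ne_zero (card_ne_zero_of_mem (hself A₀ hA₀))
  have hd' : ((d : ℝ) + 1) = ℓ.choose t - (ℓ - t).choose t := by
    rw [← hΓ A₀ hA₀, hd]; push_cast; ring
  obtain ⟨x, hx0, hx1, hpx⟩ := exists_le_mul_one_sub_pow d _ (hd' ▸ h)
  have hlll := lovasz_local_lemma E (powersetCard t univ) Γ d _ x hx0 hx1 hpx hself
    (fun A hA => by
      have : (#(Γ A) : ℝ) = d + 1 := by rw [hΓ A hA, hd']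
      exact_mod_cast this.le)
    fun A hA T hT hdisj => card_esymm_eq_zero_and_avoid_le
      (hmt.trans (mem_powersetCard.1 hA).2.ge) fun B hB => by
        by_contra hAB
        exact disjoint_left.1 hdisj hB (mem_filter.2 ⟨hT hB, hAB⟩)
  have hpos : 0 < Nat.card {S // ∀ B ∈ powersetCard t univ, ¬ E B S} := by
    have hΩ : (0 : ℝ) < Nat.card (Fin ℓ → Fin n → F) := by exact_mod_cast Nat.card_pos
    have hx : 0 < 1 - x := by linarith
    exact_mod_cast (by positivity : 0 < (1 - x) ^ _ * _).trans_le hlll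
  obtain ⟨⟨S, hS⟩⟩ := (Nat.card_pos_iff.1 hpos).1
  refine ⟨S, fun f hf => ?_⟩
  have hfS := hS (univ.map ⟨f, hf.injective⟩) (mem_powersetCard.2 ⟨subset_univ _, by simp⟩)
  rwa [show E _ S ↔ _ from Eq.congr_left (sum_powersetCard_prod_map _ _ _ _)] at hfS
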